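/- (Lemma 5.3, strengthened Tukia–Väisälä chain lemma.) Let X be a locally compact metric space that is doubling with constant N and has C0-bounded turning. Then there is an integer M ∈ ℕ, depending only on N and C0, such that every pair of points x, x' ∈ X with d(x,x') = 8r may be joined by a finite sequence x = x_0, x_1, …, x_N' = x' with N' ≤ M, all points lying in the ball B(x, C0·d(x,x')), such that d(x_0,x_1) = 2r/3 and, for every 1 ≤ j ≤ N'−1, d(x_j,x_{j+1}) ≤ d(x_{j-1},x_j) − r/(3M), with equality whenever j < N'−1. -/

import Mathlib

open Metric Set Filter Topology MeasureTheory ENNReal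

noncomputable section

/-- Every `(r/2)`-separated subset of `A ∩ B(x,r)` (with `x ∈ A`) has at most `N` points. -/
def DoublingOn {X : Type*} [MetricSpace X] (A : Set X) (N : ℕ) : Prop :=
  ∀ x ∈ A, ∀ r : ℝ, ∀ s : Finset X,
    (↑s ⊆ A ∩ Metric.ball x r) →
    (∀ y ∈ s, ∀ z ∈ s, y ≠ z → r / 2 ≤ dist y z) →
    s.card ≤ N

/-- A metric space is doubling with constant `N`. -/
def DoublingWith (X : Type*) [MetricSpace X] (N : ℕ) : Prop :=
  DoublingOn (Set.univ : Set X) N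

/-- A metric space is locally doubling with constant `N`: every point has a ball around it
that is doubling with constant `N`. -/
def LocallyDoublingWith (X : Type*) [MetricSpace X] (N : ℕ) : Prop :=
  ∀ x : X, ∃ r : ℝ, 0 < r ∧ DoublingOn (Metric.ball x r) N

/-- A metric space is locally doubling. -/
def LocallyDoubling (X : Type*) [MetricSpace X] : Prop :=
  ∃ N : ℕ, LocallyDoublingWith X N

/-- `C`-bounded turning: every two points lie in a compact connected set of diameter
at most `C` times their distance. -/
def BoundedTurningWith (X : Type*) [MetricSpace X] (C : ℝ) : Prop :=
  ∀ x y : X, ∃ K : Set X, IsCompact K ∧ IsConnected K ∧ x ∈ K ∧ y ∈ K ∧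
    Metric.diam K ≤ C * dist x y

/-- The distance from `z` to the boundary `∂Z = Z̄ ∖ Z` of `Z` in its completion,
as an extended real number (`∞` if the boundary is empty). -/
def boundaryDist (Z : Type*) [MetricSpace Z] (z : Z) : ℝ≥0∞ :=
  EMetric.infEdist ((z : UniformSpace.Completion Z))
    ((Set.range ((↑) : Z → UniformSpace.Completion Z))ᶜ)

/-- `Z` is `λ`-linearly locally `n`-connected: for every `z ∈ Z`, every radius `r` with
`0 < r < 2 d(z,∂Z)/λ` and every `0 ≤ k ≤ n`, every continuous map of the `k`-sphere into
`B(z,r)` extends to a continuous map of the closed `(k+1)`-ball into `B(z, λ r /2)`. -/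
def IsLLC (Z : Type*) [MetricSpace Z] (lam : ℝ) (n : ℕ) : Prop :=
  ∀ (z : Z) (r : ℝ), 0 < r →
    ENNReal.ofReal (lam * r / 2) < boundaryDist Z z →
    ∀ k : ℕ, k ≤ n →
      ∀ σ : C(Metric.sphere (0 : EuclideanSpace ℝ (Fin (k + 1))) 1, Z),
        (∀ p, σ p ∈ Metric.ball z r) →
        ∃ τ : C(Metric.closedBall (0 : EuclideanSpace ℝ (Fin (k + 1))) 1, Z),
          (∀ p, τ p ∈ Metric.ball z (lam * r / 2)) ∧
          ∀ p : Metric.sphere (0 : EuclideanSpace ℝ (Fin (k + 1))) 1,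
            τ ⟨(p : EuclideanSpace ℝ (Fin (k + 1))),
                Metric.sphere_subset_closedBall p.2⟩ = σ p

/-- `X` is locally `λ`-LLC^n : every point has a `λ`-LLC^n neighborhood. -/
def LocallyLLC (X : Type*) [MetricSpace X] (lam : ℝ) (n : ℕ) : Prop :=
  ∀ x : X, ∃ U ∈ 𝓝 x, IsLLC U lam n

/-- A continuous, discrete and open map. -/
def IsBranchedCovering {X Y : Type*} [TopologicalSpace X] [TopologicalSpace Y]
    (f : X → Y) : Prop :=
  Continuous f ∧ IsOpenMap f ∧ ∀ y : Y, DiscreteTopology (f ⁻¹' {y})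

/-- `L_f(x,r) = sup {d(f x, f y) : d(x,y) = r}`. -/
def dilL {X Y : Type*} [MetricSpace X] [MetricSpace Y] (f : X → Y) (x : X) (r : ℝ) : ℝ :=
  sSup ((fun y => dist (f x) (f y)) '' {y : X | dist x y = r})

/-- `l_f(x,r) = inf {d(f x, f y) : d(x,y) = r}`. -/
def dill {X Y : Type*} [MetricSpace X] [MetricSpace Y] (f : X → Y) (x : X) (r : ℝ) : ℝ :=
  sInf ((fun y => dist (f x) (f y)) '' {y : X | dist x y = r})

/-- `H_f(x,r) = L_f(x,r)/l_f(x,r)`. -/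
def dilH {X Y : Type*} [MetricSpace X] [MetricSpace Y] (f : X → Y) (x : X) (r : ℝ) : ℝ :=
  dilL f x r / dill f x r

/-- The linear dilatation `H_f(x) = limsup_{r → 0⁺} H_f(x,r)`, as an extended real. -/
def dilHlim {X Y : Type*} [MetricSpace X] [MetricSpace Y] (f : X → Y) (x : X) : ℝ≥0∞ :=
  Filter.limsup (fun r : ℝ => ENNReal.ofReal (dilH f x r)) (𝓝[>] (0 : ℝ))

/-- `S_{H,R} = {x : H_f(x,r) ≤ H for all 0 < r < R}`. -/
def SHR {X Y : Type*} [MetricSpace X] [MetricSpace Y] (f : X → Y) (H R : ℝ) : Set X :=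
  {x : X | ∀ r : ℝ, 0 < r → r < R → dilH f x r ≤ H}

/-- `U(x,s)`: the connected component of `x` in `f⁻¹(B(f x, s))`. -/
def Ucomp {X Y : Type*} [MetricSpace X] [MetricSpace Y] (f : X → Y) (x : X) (s : ℝ) :
    Set X :=
  connectedComponentIn (f ⁻¹' Metric.ball (f x) s) x

/-- `L*_f(x,s) = sup {d(x,z) : z ∈ ∂U(x,s)}`. -/
def dilLstar {X Y : Type*} [MetricSpace X] [MetricSpace Y] (f : X → Y) (x : X) (s : ℝ) : ℝ :=
  sSup ((fun z => dist x z) '' frontier (Ucomp f x s))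

/-- `l*_f(x,s) = inf {d(x,z) : z ∈ ∂U(x,s)}`. -/
def dillstar {X Y : Type*} [MetricSpace X] [MetricSpace Y] (f : X → Y) (x : X) (s : ℝ) : ℝ :=
  sInf ((fun z => dist x z) '' frontier (Ucomp f x s))

/-- `H*_f(x,s) = L*_f(x,s)/l*_f(x,s)`. -/
def dilHstar {X Y : Type*} [MetricSpace X] [MetricSpace Y] (f : X → Y) (x : X) (s : ℝ) : ℝ :=
  dilLstar f x s / dillstar f x s

/-- The inverse linear dilatation `H*_f(x) = limsup_{s → 0⁺} H*_f(x,s)`. -/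
def dilHstarlim {X Y : Type*} [MetricSpace X] [MetricSpace Y] (f : X → Y) (x : X) : ℝ≥0∞ :=
  Filter.limsup (fun s : ℝ => ENNReal.ofReal (dilHstar f x s)) (𝓝[>] (0 : ℝ))

/-- `S*_{H,R} = {x : H*_f(x,s) ≤ H for all 0 < s < R}`. -/
def SstarHR {X Y : Type*} [MetricSpace X] [MetricSpace Y] (f : X → Y) (H R : ℝ) : Set X :=
  {x : X | ∀ s : ℝ, 0 < s → s < R → dilHstar f x s ≤ H}

/-- `g : B̄(f x₀, r) → X` is a local left homotopy inverse for `f` at `x₀` (at scale `r`):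
`g ∘ f` restricted to the closure of `U(x₀,r)` is homotopic in `X` to the inclusion, via a
homotopy avoiding `x₀` on `∂U(x₀,r)`. -/
def IsLocalLeftHtpyInv {X Y : Type*} [MetricSpace X] [MetricSpace Y] (f : X → Y) (x0 : X)
    (r : ℝ) (g : C(Metric.closedBall (f x0) r, X)) : Prop :=
  ∃ hf : ∀ z ∈ closure (Ucomp f x0 r), f z ∈ Metric.closedBall (f x0) r,
  ∃ Hom : C(unitInterval × ↥(closure (Ucomp f x0 r)), X),
    (∀ z : ↥(closure (Ucomp f x0 r)), Hom (0, z) = (z : X)) ∧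
    (∀ z : ↥(closure (Ucomp f x0 r)), Hom (1, z) = g ⟨f (z : X), hf z.1 z.2⟩) ∧
    (∀ (t : unitInterval) (z : ↥(closure (Ucomp f x0 r))),
      (z : X) ∈ frontier (Ucomp f x0 r) → Hom (t, z) ≠ x0)

/-- `g : B̄(f x₀, r) → X` is a local right homotopy inverse for `f` at `x₀` (at scale `r`):
`f ∘ g` is homotopic in `Y` to the inclusion of `B̄(f x₀, r)`, via a homotopy avoiding
`f x₀` on `∂B(f x₀, r)`. -/
def IsLocalRightHtpyInv {X Y : Type*} [MetricSpace X] [MetricSpace Y] (f : X → Y) (x0 : X)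
    (r : ℝ) (g : C(Metric.closedBall (f x0) r, X)) : Prop :=
  ∃ Hom : C(unitInterval × ↥(Metric.closedBall (f x0) r), Y),
    (∀ w : ↥(Metric.closedBall (f x0) r), Hom (0, w) = (w : Y)) ∧
    (∀ w : ↥(Metric.closedBall (f x0) r), Hom (1, w) = f (g w)) ∧
    (∀ (t : unitInterval) (w : ↥(Metric.closedBall (f x0) r)),
      (w : Y) ∈ frontier (Metric.ball (f x0) r) → Hom (t, w) ≠ f x0)

/-- The left homotopy branch set `B_f^{*,l}`. -/
def leftHtpyBranchSet {X Y : Type*} [MetricSpace X] [MetricSpace Y] (f : X → Y) : Set X :=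
  {x0 : X | ¬ ∃ r : ℝ, 0 < r ∧ ∃ g : C(Metric.closedBall (f x0) r, X),
    IsLocalLeftHtpyInv f x0 r g}

/-- The (two-sided) homotopy branch set `B_f^{*}`. -/
def htpyBranchSet {X Y : Type*} [MetricSpace X] [MetricSpace Y] (f : X → Y) : Set X :=
  {x0 : X | ¬ ∃ r : ℝ, 0 < r ∧ ∃ g : C(Metric.closedBall (f x0) r, X),
    IsLocalLeftHtpyInv f x0 r g ∧ IsLocalRightHtpyInv f x0 r g}

/-- The quantity `liminf_{r→0⁺} (1/r) sup {ρ > 0 : ∃ z, B(z,ρ) ⊆ B(x,r) ∖ E}`. -/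
def porosityAt {X : Type*} [MetricSpace X] (E : Set X) (x : X) : ℝ :=
  Filter.liminf (fun r : ℝ =>
      (1 / r) * sSup {ρ : ℝ | 0 < ρ ∧ ∃ z : X, Metric.ball z ρ ⊆ Metric.ball x r \ E})
    (𝓝[>] (0 : ℝ))

/-- `E` is `δ`-porous. -/
def IsPorousWith {X : Type*} [MetricSpace X] (δ : ℝ) (E : Set X) : Prop :=
  ∀ x ∈ E, δ ≤ porosityAt E x

/-- `E` is countably `δ`-porous: a countable union of `δ`-porous sets. -/
def IsCtblPorousWith {X : Type*} [MetricSpace X] (δ : ℝ) (E : Set X) : Prop :=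
  ∃ g : ℕ → Set X, E = ⋃ i, g i ∧ ∀ i, IsPorousWith δ (g i)

/-- `S` is `δ`-dense at `x₀` (at some scale): for all sufficiently small `r > 0`,
`B(x₀,r) ⊆ ⋃_{s ∈ S} B(s, δ r)`. -/
def DenseAtWith {X : Type*} [MetricSpace X] (S : Set X) (δ : ℝ) (x0 : X) : Prop :=
  ∃ R0 : ℝ, 0 < R0 ∧ ∀ r : ℝ, 0 < r → r < R0 →
    Metric.ball x0 r ⊆ ⋃ s ∈ S, Metric.ball s (δ * r)

/-- A locally doubling Borel measure. -/
def IsLocallyDoublingMeasure {X : Type*} [MetricSpace X] [MeasurableSpace X]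
    (μ : Measure X) : Prop :=
  ∃ C : ℝ≥0∞, 1 ≤ C ∧ ∀ x : X, ∃ rx : ℝ, 0 < rx ∧ ∀ r : ℝ, 0 < r → r < rx →
    0 < μ (Metric.ball x (2 * r)) ∧
    μ (Metric.ball x (2 * r)) ≤ C * μ (Metric.ball x r) ∧
    μ (Metric.ball x (2 * r)) < ⊤

/-- Ahlfors `Q`-regularity with constant `C` (w.r.t. `Q`-dimensional Hausdorff measure). -/
def AhlforsRegularWith (Z : Type*) [MetricSpace Z] [MeasurableSpace Z] [BorelSpace Z]
    (Q C : ℝ) : Prop :=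
  1 ≤ C ∧ ∀ (z : Z) (r : ℝ), 0 < r → ENNReal.ofReal r < EMetric.diam (Set.univ : Set Z) →
    ENNReal.ofReal (C⁻¹ * r ^ Q) ≤ μH[Q] (Metric.ball z r) ∧
    μH[Q] (Metric.ball z r) ≤ ENNReal.ofReal (C * r ^ Q)

end

universe u

/-- **Boundary bumping** for balls: in a compact preconnected set `E`, a point `b` at distance more
than `ρ` from `a ∈ E` is joined, within `E` and outside `ball a ρ`, to a point at distance exactly
`ρ` from `a`. -/
theorem IsPreconnected.exists_subset_diff_ball {X : Type*} [MetricSpace X] {E : Set X}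
    (hE : IsCompact E) (hconn : IsPreconnected E) {a b : X} (ha : a ∈ E) (hb : b ∈ E) {ρ : ℝ}
    (hρ : 0 < ρ) (hab : ρ < dist a b) :
    ∃ F ⊆ E, IsCompact F ∧ IsPreconnected F ∧ b ∈ F ∧ (∀ z ∈ F, ρ ≤ dist a z) ∧
      ∃ y ∈ F, dist a y = ρ := by
  have hGc : IsCompact (E \ ball a ρ) := hE.diff isOpen_ball
  have hdist : ∀ z ∈ E \ ball a ρ, ρ ≤ dist a z := fun z hz => by
    simpa [dist_comm z a] using hz.2
  have hbG : b ∈ E \ ball a ρ := ⟨hb, by simpa [dist_comm b a] using hab.le⟩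
  have : CompactSpace ↥(E \ ball a ρ) := isCompact_iff_compactSpace.mp hGc
  set b' : ↥(E \ ball a ρ) := ⟨b, hbG⟩
  refine ⟨Subtype.val '' connectedComponent b', ?_, ?_, ?_, ?_, ?_, ?_⟩
  · rintro _ ⟨z, -, rfl⟩
    exact z.2.1
  · exact isClosed_connectedComponent.isCompact.image continuous_subtype_val
  · exact isPreconnected_connectedComponent.image _ continuous_subtype_val.continuousOn
  · exact ⟨b', mem_connectedComponent, rfl⟩
  · rintro _ ⟨z, -, rfl⟩
    exact hdist z z.2
  · by_contra! hne
    have hS : IsClosed {z : ↥(E \ ball a ρ) | dist a z ≤ ρ} :=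
      isClosed_le (by fun_prop) continuous_const
    obtain ⟨V, hV, hbV, hVS⟩ : ∃ V : Set ↥(E \ ball a ρ), IsClopen V ∧ b' ∈ V ∧
        ∀ z ∈ V, ρ < dist a z := by
      have hsub : ⋂ s : { s : Set ↥(E \ ball a ρ) // IsClopen s ∧ b' ∈ s }, (s : Set _) ⊆
          {z : ↥(E \ ball a ρ) | dist a z ≤ ρ}ᶜ := by
        rw [← connectedComponent_eq_iInter_isClopen]
        intro z hz hzS
        exact hne z ⟨z, hz, rfl⟩ (le_antisymm hzS (hdist z z.2))
      have : Nonempty { s : Set ↥(E \ ball a ρ) // IsClopen s ∧ b' ∈ s } :=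
        ⟨⟨univ, isClopen_univ, mem_univ b'⟩⟩
      obtain ⟨s, hs⟩ := exists_subset_nhds_of_compactSpace
        (V := fun s : { s : Set ↥(E \ ball a ρ) // IsClopen s ∧ b' ∈ s } => (s : Set _))
        (fun s t => ⟨⟨s ∩ t, s.2.1.inter t.2.1, s.2.2, t.2.2⟩, inter_subset_left,
          inter_subset_right⟩) (fun s => s.2.1.isClosed)
        (fun z hz => hS.isOpen_compl.mem_nhds (hsub hz))
      exact ⟨s, s.2.1, s.2.2, fun z hz => not_le.mp (hs hz)⟩
    obtain ⟨U, hU, hUV⟩ := isOpen_induced_iff.mp hV.isOpen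
    have hVc : IsClosed (Subtype.val '' V) :=
      (hV.isClosed.isCompact.image continuous_subtype_val).isClosed
    have hUo : IsOpen (U ∩ {z | ρ < dist a z}) :=
      hU.inter (isOpen_lt continuous_const (by fun_prop))
    have hmem : ∀ z ∈ E, z ∈ U ∩ {z | ρ < dist a z} → z ∈ Subtype.val '' V := by
      rintro z hzE ⟨hzU, hz⟩
      have hzG : z ∈ E \ ball a ρ := ⟨hzE, by
        simpa [dist_comm z a] using (show ρ < dist a z from hz).le⟩
      exact ⟨⟨z, hzG⟩, hUV ▸ hzU, rfl⟩
    have hmem' : ∀ z ∈ Subtype.val '' V, z ∈ U ∩ {z | ρ < dist a z} := by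
      rintro _ ⟨z, hz, rfl⟩
      exact ⟨by rw [← hUV] at hz; exact hz, hVS z hz⟩
    have haV : a ∉ Subtype.val '' V := fun h => by
      have := (hmem' a h).2
      simp only [mem_ofPred_eq, dist_self] at this
      linarith
    obtain ⟨z, hzE, hz, hz'⟩ := hconn _ _ hUo hVc.isOpen_compl
      (fun z hz => (em (z ∈ Subtype.val '' V)).imp (hmem' z) id)
      ⟨b, hb, hmem' b ⟨b', hbV, rfl⟩⟩ ⟨a, ha, haV⟩
    exact hz' (hmem z hzE hz)

/-- In a doubling space, a `R / 2 ^ (k + 1)`-separated subset of a ball of radius `R` has at most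
`N ^ (k + 1)` points. -/
theorem DoublingWith.card_le_pow {X : Type*} [MetricSpace X] {N : ℕ} (hX : DoublingWith X N)
    (k : ℕ) (x : X) (R : ℝ) (s : Finset X) (hs : ↑s ⊆ ball x R)
    (hsep : ∀ y ∈ s, ∀ z ∈ s, y ≠ z → R / 2 ^ (k + 1) ≤ dist y z) : s.card ≤ N ^ (k + 1) := by
  classical
  induction k generalizing x R s with
  | zero => simpa using hX x (mem_univ x) R s (by simpa using hs) (by simpa using hsep)
  | succ k ih =>
    obtain ⟨t, ht⟩ := (s.powerset.filter fun t => ∀ y ∈ t, ∀ z ∈ t, y ≠ z →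
      R / 2 ≤ dist y z).exists_maximal ⟨∅, by simp⟩
    have htmem := ht.prop
    simp only [Finset.mem_filter, Finset.mem_powerset] at htmem
    obtain ⟨hts, htsep⟩ := htmem
    have htcard : t.card ≤ N := hX x (mem_univ x) R t
      (by simpa using (Finset.coe_subset.mpr hts).trans hs) htsep
    have hcover : s ⊆ t.biUnion fun y => s.filter (· ∈ ball y (R / 2)) := by
      intro z hz
      simp only [Finset.mem_biUnion, Finset.mem_filter, mem_ball]
      by_contra! hfar
      have hzt : ∀ y ∈ t, R / 2 ≤ dist z y := fun y hy => hfar y hy hz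
      have hins : insert z t ∈ s.powerset.filter fun t => ∀ y ∈ t, ∀ z ∈ t, y ≠ z →
          R / 2 ≤ dist y z := by
        simp only [Finset.mem_filter, Finset.mem_powerset, Finset.insert_subset_iff]
        refine ⟨⟨hz, hts⟩, fun u hu v hv huv => ?_⟩
        rcases Finset.mem_insert.mp hu with rfl | hut <;>
          rcases Finset.mem_insert.mp hv with rfl | hvt
        · exact absurd rfl huv
        · exact hzt v hvt
        · exact dist_comm v u ▸ hzt u hut
        · exact htsep u hut v hvt huv
      have hz_mem : z ∈ t := ht.le_of_ge hins (Finset.subset_insert z t)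
        (Finset.mem_insert_self z t)
      have hR : 0 < R := dist_nonneg.trans_lt (mem_ball.mp (hs hz))
      have := hzt z hz_mem
      rw [dist_self] at this
      linarith
    calc s.card ≤ (t.biUnion fun y => s.filter (· ∈ ball y (R / 2))).card :=
          Finset.card_le_card hcover
      _ ≤ t.card * N ^ (k + 1) := by
          refine Finset.card_biUnion_le_card_mul _ _ _ fun y _ => ?_
          refine ih y (R / 2) _ (fun z hz => (Finset.mem_filter.mp hz).2) fun u hu v hv huv => ?_
          rw [div_div, ← pow_succ']
          exact hsep u (Finset.mem_filter.mp hu).1 v (Finset.mem_filter.mp hv).1 huv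
      _ ≤ N * N ^ (k + 1) := Nat.mul_le_mul_right _ htcard
      _ = N ^ (k + 1 + 1) := (pow_succ' N (k + 1)).symm

/-- A chain `c 0, …, c n` in `K` with prescribed step lengths `ρ i`, in which every `c i` keeps
distance at least `ρ i` from all later points. -/
structure IsHoppingChain {X : Type*} [MetricSpace X] (K : Set X) (ρ : ℕ → ℝ) (n : ℕ)
    (c : ℕ → X) : Prop where
  mem : ∀ j ≤ n, c j ∈ K
  dist_succ : ∀ i < n, dist (c i) (c (i + 1)) = ρ i
  le_dist : ∀ i j, i < j → j ≤ n → ρ i ≤ dist (c i) (c j)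

/-- In a compact preconnected set one may hop from `x` towards `x'` with prescribed step lengths,
unless `x'` comes within reach of a step. -/
theorem IsPreconnected.exists_isHoppingChain {X : Type*} [MetricSpace X] {K : Set X}
    (hK : IsCompact K) (hconn : IsPreconnected K) {x x' : X} (hx : x ∈ K) (hx' : x' ∈ K)
    {ρ : ℕ → ℝ} {M : ℕ} (hρ : ∀ i < M, 0 < ρ i)
    (hfar : ∀ n < M, ∀ c, IsHoppingChain K ρ n c → c 0 = x → ρ n < dist (c n) x') :
    ∃ c, IsHoppingChain K ρ M c ∧ c 0 = x := by
  suffices h : ∀ n ≤ M, ∃ c, IsHoppingChain K ρ n c ∧ c 0 = x ∧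
      ∃ E ⊆ K, IsCompact E ∧ IsPreconnected E ∧ c n ∈ E ∧ x' ∈ E ∧
        ∀ i < n, ∀ z ∈ E, ρ i ≤ dist (c i) z by
    obtain ⟨c, hc, hc0, -⟩ := h M le_rfl
    exact ⟨c, hc, hc0⟩
  intro n hn
  induction n with
  | zero =>
    exact ⟨fun _ => x, ⟨fun _ _ => hx, fun i hi => absurd hi i.not_lt_zero,
      fun i j hij hj => by omega⟩, rfl, K, Subset.rfl, hK, hconn, hx, hx',
      fun i hi => absurd hi i.not_lt_zero⟩
  | succ n ih =>
    obtain ⟨c, hc, hc0, E, hEK, hE, hEconn, hcE, hxE, hEfar⟩ := ih (by omega)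
    obtain ⟨F, hFE, hF, hFconn, hxF, hFfar, y, hyF, hy⟩ :=
      hEconn.exists_subset_diff_ball hE hcE hxE
        (hρ n (by omega)) (hfar n (by omega) c hc hc0)
    have hold : ∀ j ≤ n, Function.update c (n + 1) y j = c j := fun j hj =>
      Function.update_of_ne (by omega) _ _
    have hnew : Function.update c (n + 1) y (n + 1) = y := Function.update_self _ _ _
    have hFfar' : ∀ i < n + 1, ∀ z ∈ F, ρ i ≤ dist (c i) z := fun i hi z hz => by
      rcases Nat.lt_succ_iff_lt_or_eq.mp hi with hi | rfl
      · exact hEfar i hi z (hFE hz)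
      · exact hFfar z hz
    refine ⟨Function.update c (n + 1) y, ⟨fun j hj => ?_, fun i hi => ?_, fun i j hij hj => ?_⟩,
      (hold 0 n.zero_le).trans hc0, F, hFE.trans hEK, hF, hFconn, hnew.symm ▸ hyF, hxF,
      fun i hi z hz => hold i (by omega) ▸ hFfar' i hi z hz⟩
    · rcases Nat.le_succ_iff.mp hj with hj | rfl
      · exact hold j hj ▸ hc.mem j hj
      · exact hnew.symm ▸ hEK (hFE hyF)
    · rw [hold i (by omega)]
      rcases Nat.lt_succ_iff_lt_or_eq.mp hi with hi | rfl
      · rw [hold (i + 1) hi]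
        exact hc.dist_succ i hi
      · rw [hnew, hy]
    · rw [hold i (by omega)]
      rcases Nat.le_succ_iff.mp hj with hj | rfl
      · rw [hold j hj]
        exact hc.le_dist i j hij hj
      · rw [hnew]
        exact hFfar' i hij y hyF

/-- **Lemma 5.3 (strengthened Tukia–Väisälä chain lemma).**
If `X` is doubling with constant `N` and has `C₀`-bounded turning, then there is
`M ∈ ℕ`, depending only on `N` and `C₀`, such that every pair `x, x'` with
`d(x,x') = 8r` can be joined by a chain `x = c 0, …, c N' = x'`, `N' ≤ M`, of points of
`B̄(x, C₀ d(x,x'))` with `d(c 0, c 1) = 2r/3` and, for `1 ≤ j ≤ N'-1`,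
`d(c j, c (j+1)) ≤ d(c (j-1), c j) - r/(3M)`, with equality whenever `j < N'-1`. -/
theorem chain_lemma (N : ℕ) (C0 : ℝ) (hC0 : 1 ≤ C0) :
    ∃ M : ℕ, 1 ≤ M ∧
      ∀ (X : Type u) [MetricSpace X], LocallyCompactSpace X →
        DoublingWith X N → BoundedTurningWith X C0 →
        ∀ (x x' : X) (r : ℝ), 0 < r → dist x x' = 8 * r →
          ∃ (N' : ℕ) (c : ℕ → X), 1 ≤ N' ∧ N' ≤ M ∧ c 0 = x ∧ c N' = x' ∧
            (∀ j ≤ N', c j ∈ Metric.closedBall x (C0 * dist x x')) ∧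
            dist (c 0) (c 1) = 2 * r / 3 ∧
            (∀ j : ℕ, 1 ≤ j → j + 1 ≤ N' →
              dist (c j) (c (j + 1)) ≤ dist (c (j - 1)) (c j) - r / (3 * (M : ℝ)) ∧
              (j + 1 < N' →
                dist (c j) (c (j + 1)) = dist (c (j - 1)) (c j) - r / (3 * (M : ℝ)))) := by
  obtain ⟨k, hk⟩ := pow_unbounded_of_one_lt (27 * C0) (one_lt_two)
  refine ⟨N ^ (k + 1) + 1, by omega, ?_⟩
  generalize hMdef : N ^ (k + 1) + 1 = M
  intro X _ _ hN hturn x x' r hr hxx'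
  have hM : (0 : ℝ) < M := by exact_mod_cast (show 0 < M by omega)
  obtain ⟨K, hK, hKconn, hxK, hxK', hdiam⟩ := hturn x x'
  have hKx : ∀ y ∈ K, dist y x ≤ C0 * dist x x' := fun y hy =>
    (dist_le_diam_of_mem hK.isBounded hy hxK).trans hdiam
  set ρ : ℕ → ℝ := fun j => 2 * r / 3 - j * (r / (3 * M)) with hρdef
  have hρ : ∀ i ≤ M, r / 3 ≤ ρ i := fun i hi => by
    have hi' : (i : ℝ) ≤ M := by exact_mod_cast hi
    have h1 : (i : ℝ) * (r / (3 * M)) ≤ M * (r / (3 * M)) := by gcongr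
    have h2 : (M : ℝ) * (r / (3 * M)) = r / 3 := by field_simp
    simp only [hρdef]
    linarith
  have hρsucc : ∀ j, 1 ≤ j → ρ j = ρ (j - 1) - r / (3 * M) := fun j hj => by
    simp only [hρdef, Nat.cast_sub hj]
    push_cast
    ring
  obtain ⟨n, hn, c, hc, hc0, hclose⟩ : ∃ n < M, ∃ c, IsHoppingChain K ρ n c ∧ c 0 = x ∧
      dist (c n) x' ≤ ρ n := by
    by_contra! hfar
    obtain ⟨c, hc, -⟩ := hKconn.isPreconnected.exists_isHoppingChain hK hxK hxK'
      (fun i hi => (by positivity : 0 < r / 3).trans_le (hρ i hi.le)) hfar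
    have hsep : ∀ i ≤ M, ∀ j ≤ M, i ≠ j → r / 3 ≤ dist (c i) (c j) := fun i hi j hj hij => by
      rcases lt_or_gt_of_ne hij with h | h
      · exact (hρ i hi).trans (hc.le_dist i j h hj)
      · exact dist_comm (c j) (c i) ▸ (hρ j hj).trans (hc.le_dist j i h hi)
    classical
    have hcard : ((Finset.range M).image c).card = M := by
      rw [Finset.card_image_of_injOn, Finset.card_range]
      intro i hi j hj hij
      by_contra hne
      have := hsep i (Finset.mem_range.mp hi).le j (Finset.mem_range.mp hj).le hne
      rw [hij, dist_self] at this
      linarith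
    have hle := hN.card_le_pow k x (9 * C0 * r) ((Finset.range M).image c) ?_ ?_
    · omega
    · intro y hy
      obtain ⟨i, hi, rfl⟩ := Finset.mem_image.mp (Finset.mem_coe.mp hy)
      have := hKx _ (hc.mem i (Finset.mem_range.mp hi).le)
      rw [mem_ball]
      rw [hxx'] at this
      nlinarith
    · intro y hy z hz hyz
      obtain ⟨i, hi, rfl⟩ := Finset.mem_image.mp hy
      obtain ⟨j, hj, rfl⟩ := Finset.mem_image.mp hz
      refine le_trans ?_ (hsep i (Finset.mem_range.mp hi).le j (Finset.mem_range.mp hj).le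
        fun h => hyz (h ▸ rfl))
      rw [div_le_iff₀ (by positivity), pow_succ]
      nlinarith
  have hn0 : 1 ≤ n := by
    by_contra! h
    obtain rfl : n = 0 := by omega
    simp only [hρdef, hc0, hxx'] at hclose
    norm_num at hclose
    linarith
  have hold : ∀ j ≤ n, Function.update c (n + 1) x' j = c j := fun j hj =>
    Function.update_of_ne (by omega) _ _
  have hnew : Function.update c (n + 1) x' (n + 1) = x' := Function.update_self _ _ _
  refine ⟨n + 1, Function.update c (n + 1) x', by omega, hn, (hold 0 n.zero_le).trans hc0, hnew,
    fun j hj => ?_, ?_, fun j hj hjn => ?_⟩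
  · rw [mem_closedBall]
    rcases Nat.le_succ_iff.mp hj with hj | rfl
    · exact hold j hj ▸ hKx _ (hc.mem j hj)
    · exact hnew.symm ▸ hKx _ hxK'
  · rw [hold 0 n.zero_le, hold 1 hn0, hc.dist_succ 0 hn0]
    simp [hρdef]
  · have hprev : dist (c (j - 1)) (c j) = ρ (j - 1) := by
      have := hc.dist_succ (j - 1) (by omega)
      rwa [Nat.sub_add_cancel hj] at this
    rw [hold j (by omega), hold (j - 1) (by omega), hprev, ← hρsucc j hj]
    rcases Nat.lt_or_ge j n with h | h
    · rw [hold (j + 1) h, hc.dist_succ j h]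
      exact ⟨le_rfl, fun _ => rfl⟩
    · obtain rfl : j = n := by omega
      exact ⟨hnew.symm ▸ hclose, fun h => absurd h (lt_irrefl _)⟩
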